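/- If C is a reduced homogeneous perfect code of length n, then the Vasil'ev code V_C^0 (built with the identically zero function λ ≡ 0) is a homogeneous perfect code of length 2n+1. -/

import Mathlib

set_option linter.unusedSectionVars false

/-- Binary vectors of length `|ι|`, indexed by `ι`. -/
abbrev F (ι : Type*) : Type _ := ι → ZMod 2

section Defs

variable {ι : Type*}

/-- The support of a vector: the set of its nonzero coordinate positions. -/
def supp (x : F ι) : Set ι := {i | x i ≠ 0}

/-- Action of a permutation on binary vectors by permuting coordinates:
`(permAct π x) (π i) = x i`. -/
def permAct (π : Equiv.Perm ι) (x : F ι) : F ι := x ∘ π.symm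

/-- The image `π(C)` of a code under a coordinate permutation. -/
def permCode (π : Equiv.Perm ι) (C : Set (F ι)) : Set (F ι) := permAct π '' C

/-- The translateCode `y + C` of a code. -/
def translateCode (y : F ι) (C : Set (F ι)) : Set (F ι) := (y + ·) '' C

/-- `Sym(C) = {π : π(C) = C}`. -/
def SymSet (C : Set (F ι)) : Set (Equiv.Perm ι) := {π | permCode π C = C}

/-- `Rot(C) = {π : ∃ y ∈ C, y + π(C) = C}`. -/
def RotSet (C : Set (F ι)) : Set (Equiv.Perm ι) :=
  {π | ∃ y ∈ C, translateCode y (permCode π C) = C}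

/-- `Rot_y(C) = {π : y + π(C) = C}`. -/
def RotAt (C : Set (F ι)) (y : F ι) : Set (Equiv.Perm ι) :=
  {π | translateCode y (permCode π C) = C}

/-- `Tr(C) = {y ∈ C : ∃ π, y + π(C) = C}`. -/
def TrSet (C : Set (F ι)) : Set (F ι) :=
  {y | y ∈ C ∧ ∃ π : Equiv.Perm ι, translateCode y (permCode π C) = C}

/-- `Ker(C) = {x ∈ C : x + C = C}`. -/
def KerSet (C : Set (F ι)) : Set (F ι) := {x | x ∈ C ∧ translateCode x C = C}

/-- `Aut(C) = {(y, π) : y + π(C) = C}`. -/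
def AutSet (C : Set (F ι)) : Set (F ι × Equiv.Perm ι) :=
  {p | translateCode p.1 (permCode p.2 C) = C}

/-- A (reduced) code is transitive if for every codeword `y` there is a permutation `π`
with `y + π(C) = C`. -/
def IsTransitive (C : Set (F ι)) : Prop :=
  ∀ y ∈ C, ∃ π : Equiv.Perm ι, translateCode y (permCode π C) = C

/-- A code is propelinear if `Aut(C)` contains a subgroup acting regularly on `C`
(the group law is `(y, π) * (y', π') = (y + π(y'), π ∘ π')`, acting by `(y,π) • x = y + π(x)`). -/
def IsPropelinear (C : Set (F ι)) : Prop :=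
  ∃ A : Set (F ι × Equiv.Perm ι),
    (∀ a ∈ A, translateCode a.1 (permCode a.2 C) = C) ∧
    ((0, 1) ∈ A) ∧
    (∀ a ∈ A, ∀ b ∈ A, (a.1 + permAct a.2 b.1, a.2 * b.2) ∈ A) ∧
    (∀ a ∈ A, (permAct a.2⁻¹ a.1, a.2⁻¹) ∈ A) ∧
    (∀ c ∈ C, ∀ c' ∈ C, ∃! a, a ∈ A ∧ a.1 + permAct a.2 c = c')

variable [Fintype ι] [DecidableEq ι]

/-- A perfect (1-error-correcting) code: every vector is within Hamming distance 1 of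
exactly one codeword. -/
def IsPerfect (C : Set (F ι)) : Prop :=
  ∀ x : F ι, ∃! c, c ∈ C ∧ hammingDist x c ≤ 1

/-- `STS(C, y) = {supp (x + y) : x ∈ C, d(x, y) = 3}`. -/
def STS (C : Set (F ι)) (y : F ι) : Set (Set ι) :=
  {s | ∃ x ∈ C, hammingDist x y = 3 ∧ s = supp (x + y)}

/-- A reduced perfect code is homogeneous if each `STS(C,y)`, `y ∈ C`, is isomorphic
to `STS(C, 0)`. -/
def IsHomogeneous (C : Set (F ι)) : Prop :=
  ∀ y ∈ C, ∃ π : Equiv.Perm ι, (Set.image π) '' (STS C y) = STS C (0 : F ι)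

/-- The (mod 2) weight `|x| = x_1 + ⋯ + x_n`. -/
def wt (x : F ι) : ZMod 2 := ∑ i, x i

/-- The scalar product `u · y = Σ u_i y_i (mod 2)`. -/
def dot (u y : F ι) : ZMod 2 := ∑ i, u i * y i

/-- A linear code: a subspace of `F ι` (over `ZMod 2` it suffices to be closed under `+`). -/
def IsLinearCode (C : Set (F ι)) : Prop :=
  (0 : F ι) ∈ C ∧ ∀ x ∈ C, ∀ y ∈ C, x + y ∈ C

/-- A Hamming code: a linear perfect code. -/
def IsHammingCode (C : Set (F ι)) : Prop := IsLinearCode C ∧ IsPerfect C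

/-- The `i`-component `R_i`: the linear span of the weight-3 codewords of `H` whose
support contains `i`. -/
def component (H : Set (F ι)) (i : ι) : Set (F ι) :=
  ↑(Submodule.span (ZMod 2) {x | x ∈ H ∧ hammingNorm x = 3 ∧ x i ≠ 0})

/-- `lam` pierces `R` if it takes both values 0 and 1 on `R`. -/
def Pierces (lam : F ι → ZMod 2) (R : Set (F ι)) : Prop :=
  (∃ x ∈ R, lam x = 0) ∧ (∃ x ∈ R, lam x = 1)

/-- The vector `(a, b, c)` of length `2n+1`: coordinates `1..n` are `a`, coordinate `n+1`
is `b`, coordinates `n+2..2n+1` are `c`. -/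
def vasVec (a : F ι) (b : ZMod 2) (c : F ι) : F (ι ⊕ Unit ⊕ ι) :=
  Sum.elim a (Sum.elim (fun _ => b) c)

/-- The Vasil'ev code `V_C^λ = {(x + y, |x| + λ(y), x) : x ∈ F^n, y ∈ C}`. -/
def Vasiliev (C : Set (F ι)) (lam : F ι → ZMod 2) : Set (F (ι ⊕ Unit ⊕ ι)) :=
  {v | ∃ x : F ι, ∃ y ∈ C, v = vasVec (x + y) (wt x + lam y) x}

/-- The subspace `R_{n+1}^{2n+1} = {(x, |x|, x) : x ∈ F^n}`. -/
def Rmid : Set (F (ι ⊕ Unit ⊕ ι)) := {v | ∃ x : F ι, v = vasVec x (wt x) x}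

/-- Underlying function of `τ_u`: swaps positions `i` and `i + n + 1` for `i ∈ supp u`. -/
def tauFun (u : F ι) : (ι ⊕ Unit ⊕ ι) → (ι ⊕ Unit ⊕ ι)
  | Sum.inl i => if u i ≠ 0 then Sum.inr (Sum.inr i) else Sum.inl i
  | Sum.inr (Sum.inl _) => Sum.inr (Sum.inl ())
  | Sum.inr (Sum.inr i) => if u i ≠ 0 then Sum.inl i else Sum.inr (Sum.inr i)

theorem tauFun_involutive (u : F ι) : Function.Involutive (tauFun u) := by
  intro x
  rcases x with i | x
  · by_cases h : u i = 0 <;> simp [tauFun, h]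
  · rcases x with u' | i
    · simp [tauFun]
    · by_cases h : u i = 0 <;> simp [tauFun, h]

/-- The permutation `τ_u`: the product of transpositions `(i, i+n+1)` over `i ∈ supp u`. -/
def tau (u : F ι) : Equiv.Perm (ι ⊕ Unit ⊕ ι) :=
  Function.Involutive.toPerm (tauFun u) (tauFun_involutive u)

/-- The duplicator `σ_π`: fixes position `n+1`, sends `i ↦ π(i)` and `i+n+1 ↦ π(i)+n+1`. -/
def dup (π : Equiv.Perm ι) : Equiv.Perm (ι ⊕ Unit ⊕ ι) :=
  Equiv.sumCongr π (Equiv.sumCongr (Equiv.refl Unit) π)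

/-- The extension of `λ` one step up the Vasil'ev recursion: `λ'(z) = λ(y)` for
`z ∈ (y, 0^{m+1}) + R_{m+1}^{2m+1}` (well defined by recovering `y` from `z`). -/
def lamSucc (lam : F ι → ZMod 2) : F (ι ⊕ Unit ⊕ ι) → ZMod 2 :=
  fun z => lam (fun i => z (Sum.inl i) + z (Sum.inr (Sum.inr i)))

/-- `T = {y' ∈ H : (y', λ(y'), 0) ∈ Tr(V_H^λ)}`. -/
def Tset (H : Set (F ι)) (lam : F ι → ZMod 2) : Set (F ι) :=
  {y' | y' ∈ H ∧ vasVec y' (lam y') 0 ∈ TrSet (Vasiliev H lam)}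

/-- The Assmus–Mattson Steiner triple system `S^θ` of order `2n+1`. -/
def AM (S : Set (Set ι)) (θ : Set ι → ZMod 2) : Set (Set (ι ⊕ Unit ⊕ ι)) :=
  {T | (∃ i : ι, T = {Sum.inl i, Sum.inr (Sum.inl ()), Sum.inr (Sum.inr i)}) ∨
    (∃ s ∈ S, θ s = 0 ∧
      (T = Sum.inl '' s ∨
        ∃ a ∈ s, T = insert (Sum.inl a) ((fun i => Sum.inr (Sum.inr i)) '' (s \ {a})))) ∨
    (∃ s ∈ S, θ s = 1 ∧
      (T = (fun i => Sum.inr (Sum.inr i)) '' s ∨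
        ∃ a ∈ s, T = insert (Sum.inr (Sum.inr a)) (Sum.inl '' (s \ {a}))))}

end Defs

/-- A Steiner triple system on the point set `α`. -/
def IsSTS {α : Type*} (S : Set (Set α)) : Prop :=
  (∀ s ∈ S, s.ncard = 3) ∧ ∀ i j : α, i ≠ j → ∃! s, s ∈ S ∧ i ∈ s ∧ j ∈ s

/-- The Mollard code (with zero function) of the codes `C` and `D`. -/
def Mollard {t r : Type*} [Fintype t] [Fintype r] (C : Set (F t)) (D : Set (F r)) :
    Set (F ((t × r) ⊕ t ⊕ r)) :=
  {v | ∃ x : F (t × r), ∃ c ∈ C, ∃ d ∈ D,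
    v = Sum.elim x (Sum.elim (fun i => c i + ∑ j, x (i, j)) (fun j => d j + ∑ i, x (i, j)))}

/-- Index types of the iterated Vasil'ev construction: lengths `n`, `2n+1`, `4n+3`, …. -/
def HType (n : ℕ) : ℕ → Type
  | 0 => Fin n
  | s + 1 => HType n s ⊕ Unit ⊕ HType n s

def HType.ft (n : ℕ) : ∀ s, Fintype (HType n s)
  | 0 => inferInstanceAs (Fintype (Fin n))
  | s + 1 =>
      letI := HType.ft n s
      inferInstanceAs (Fintype (HType n s ⊕ Unit ⊕ HType n s))

instance (n s : ℕ) : Fintype (HType n s) := HType.ft n s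

def HType.deq (n : ℕ) : ∀ s, DecidableEq (HType n s)
  | 0 => inferInstanceAs (DecidableEq (Fin n))
  | s + 1 =>
      letI := HType.deq n s
      inferInstanceAs (DecidableEq (HType n s ⊕ Unit ⊕ HType n s))

instance (n s : ℕ) : DecidableEq (HType n s) := HType.deq n s

/-- The iterated Hamming codes `H^n, H^{2n+1} = V_{H^n}^0, H^{4n+3}, …`. -/
def Hcode (n : ℕ) (H : Set (F (Fin n))) : ∀ s, Set (F (HType n s))
  | 0 => H
  | s + 1 => Vasiliev (Hcode n H s) 0

/-- The iterated functions `λ_n = λ`, `λ_{2m+1}` extending `λ_m`. -/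
def lamIter (n : ℕ) (lam : F (Fin n) → ZMod 2) : ∀ s, F (HType n s) → ZMod 2
  | 0 => lam
  | s + 1 => lamSucc (lamIter n lam s)

/-- `C_0 = V_{H^n}^λ`, `C_{s+1} = V_{C_s}^0`. -/
def Ccode (n : ℕ) (H : Set (F (Fin n))) (lam : F (Fin n) → ZMod 2) :
    ∀ s, Set (F (HType n (s + 1)))
  | 0 => Vasiliev H lam
  | s + 1 => Vasiliev (Ccode n H lam s) 0

section VasilievHomogeneous

variable {ι : Type*}

theorem supp_injective : Function.Injective (supp : F ι → Set ι) := by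
  intro x y h
  funext i
  have hi : x i ≠ 0 ↔ y i ≠ 0 := Set.ext_iff.mp h i
  generalize x i = a at *
  generalize y i = b at *
  revert a b
  decide

theorem image_supp (π : Equiv.Perm ι) (x : F ι) : π '' supp x = supp (permAct π x) := by
  ext i
  rw [Equiv.image_eq_preimage_symm]
  rfl

theorem eq_of_add_eq_zero {x y : F ι} (h : x + y = 0) : x = y := by
  rwa [← ZModModule.sub_eq_add, sub_eq_zero] at h

theorem permAct_add (π : Equiv.Perm ι) (x y : F ι) :
    permAct π (x + y) = permAct π x + permAct π y := rfl

theorem permAct_dup (π : Equiv.Perm ι) (v : F (ι ⊕ Unit ⊕ ι)) :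
    permAct (dup π) v = vasVec (permAct π (v ∘ Sum.inl)) (v (Sum.inr (Sum.inl ())))
      (permAct π (v ∘ Sum.inr ∘ Sum.inr)) := by
  funext i
  rcases i with i | i | i <;> rfl

theorem vasVec_eta (v : F (ι ⊕ Unit ⊕ ι)) :
    vasVec (v ∘ Sum.inl) (v (Sum.inr (Sum.inl ()))) (v ∘ Sum.inr ∘ Sum.inr) = v := by
  funext i
  rcases i with i | i | i <;> rfl

theorem vasVec_add (a a' : F ι) (b b' : ZMod 2) (c c' : F ι) :
    vasVec a b c + vasVec a' b' c' = vasVec (a + a') (b + b') (c + c') := by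
  funext i
  rcases i with i | i | i <;> rfl

variable [Fintype ι]

theorem hammingDist_eq_hammingNorm_add (x y : F ι) : hammingDist x y = hammingNorm (x + y) := by
  rw [hammingDist_eq_hammingNorm, ZModModule.neg_eq_self]

theorem hammingNorm_add_le (x y : F ι) : hammingNorm (x + y) ≤ hammingNorm x + hammingNorm y := by
  simpa [hammingDist_eq_hammingNorm_add] using hammingDist_triangle x 0 y

theorem hammingNorm_eq_sum (x : F ι) : hammingNorm x = ∑ i, if x i ≠ 0 then 1 else 0 :=
  Finset.card_filter _ _

theorem hammingNorm_permAct (π : Equiv.Perm ι) (x : F ι) :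
    hammingNorm (permAct π x) = hammingNorm x := by
  rw [hammingNorm_eq_sum, hammingNorm_eq_sum]
  exact Equiv.sum_comp π.symm fun i => if x i ≠ 0 then 1 else 0

theorem hammingNorm_vasVec (a : F ι) (b : ZMod 2) (c : F ι) :
    hammingNorm (vasVec a b c) = hammingNorm a + (if b ≠ 0 then 1 else 0) + hammingNorm c := by
  simp only [hammingNorm_eq_sum, vasVec, Fintype.sum_sum_type, Sum.elim_inl,
    Sum.elim_inr, Finset.univ_unique, Finset.sum_singleton, add_assoc]
  rfl

theorem wt_eq_hammingNorm (x : F ι) : wt x = (hammingNorm x : ZMod 2) := by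
  rw [wt, hammingNorm, Finset.natCast_card_filter]
  refine Finset.sum_congr rfl fun i _ => ?_
  generalize x i = a
  revert a
  decide

theorem wt_add (x y : F ι) : wt (x + y) = wt x + wt y := Finset.sum_add_distrib

theorem wt_permAct (π : Equiv.Perm ι) (x : F ι) : wt (permAct π x) = wt x :=
  Equiv.sum_comp π.symm x

theorem supp_mem_STS {C : Set (F ι)} {y w : F ι} :
    supp w ∈ STS C y ↔ w + y ∈ C ∧ hammingNorm w = 3 := by
  constructor
  · rintro ⟨x, hx, hd, hs⟩
    rw [supp_injective hs, add_assoc, ZModModule.add_self, add_zero,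
      ← hammingDist_eq_hammingNorm_add]
    exact ⟨hx, hd⟩
  · rintro ⟨hw, hn⟩
    refine ⟨w + y, hw, ?_, ?_⟩
    · rwa [hammingDist_eq_hammingNorm_add, add_assoc, ZModModule.add_self, add_zero]
    · rw [add_assoc, ZModModule.add_self, add_zero]

theorem exists_supp_of_mem_STS {C : Set (F ι)} {y : F ι} {s : Set ι} (hs : s ∈ STS C y) :
    ∃ w, s = supp w := by
  obtain ⟨x, _, _, rfl⟩ := hs
  exact ⟨x + y, rfl⟩

theorem image_STS_eq_iff {C : Set (F ι)} {y z : F ι} {π : Equiv.Perm ι} :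
    Set.image π '' STS C y = STS C z ↔
      ∀ w, hammingNorm w = 3 → (w + y ∈ C ↔ permAct π w + z ∈ C) := by
  have hinj : Function.Injective (Set.image π) := π.injective.image_injective
  constructor
  · intro h w hw
    have := hinj.mem_set_image (s := STS C y) (a := supp w)
    rw [h, image_supp, supp_mem_STS, supp_mem_STS, hammingNorm_permAct] at this
    tauto
  · intro h
    have key (w : F ι) : supp (permAct π w) ∈ STS C z ↔ supp w ∈ STS C y := by
      rw [supp_mem_STS, supp_mem_STS, hammingNorm_permAct]
      specialize h w
      tauto
    ext s
    constructor
    · rintro ⟨t, ht, rfl⟩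
      obtain ⟨w, rfl⟩ := exists_supp_of_mem_STS ht
      rw [image_supp]
      exact (key w).mpr ht
    · intro hs
      obtain ⟨w, rfl⟩ := exists_supp_of_mem_STS hs
      have hw : permAct π (permAct π⁻¹ w) = w := by
        funext i
        exact congrArg w (π.apply_symm_apply i)
      refine ⟨supp (permAct π⁻¹ w), (key _).mp (by rwa [hw]), ?_⟩
      rw [image_supp, hw]

theorem vasVec_mem_Vasiliev {C : Set (F ι)} {a c : F ι} {b : ZMod 2} :
    vasVec a b c ∈ Vasiliev C 0 ↔ b = wt c ∧ a + c ∈ C := by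
  constructor
  · rintro ⟨x, y, hy, h⟩
    have ha : a = x + y := congrArg (fun v => v ∘ Sum.inl) h
    have hb : b = wt x + 0 := congrFun h (Sum.inr (Sum.inl ()))
    have hc : c = x := congrArg (fun v => v ∘ Sum.inr ∘ Sum.inr) h
    subst ha hb hc
    rw [add_zero, add_comm c y, add_assoc, ZModModule.add_self, add_zero]
    exact ⟨rfl, hy⟩
  · rintro ⟨rfl, h⟩
    refine ⟨c, a + c, h, ?_⟩
    rw [add_comm a c, ← add_assoc, ZModModule.add_self, zero_add, Pi.zero_apply, add_zero]

variable [DecidableEq ι]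

theorem IsPerfect.eq_of_hammingDist_le_two {C : Set (F ι)} (hC : IsPerfect C) {x y : F ι}
    (hx : x ∈ C) (hy : y ∈ C) (h : hammingDist x y ≤ 2) : x = y := by
  by_contra hne
  obtain ⟨i, hi⟩ := Function.ne_iff.mp hne
  have hzx : hammingDist (Function.update x i (y i)) x ≤ 1 := by
    refine (Finset.card_le_card (t := {i}) fun j hj => ?_).trans (Finset.card_singleton i).le
    by_contra hji
    simp_all
  have hzy : hammingDist (Function.update x i (y i)) y < hammingDist x y := by
    refine Finset.card_lt_card (Finset.ssubset_iff_of_subset ?_ |>.mpr ⟨i, by simpa using hi, by simp⟩)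
    intro j hj
    by_cases hji : j = i <;> simp_all
  exact hne ((hC _).unique ⟨hx, hzx⟩ ⟨hy, by omega⟩)

theorem IsPerfect.vasiliev {C : Set (F ι)} (hC : IsPerfect C) : IsPerfect (Vasiliev C 0) := by
  intro v
  obtain ⟨y, ⟨hy, hyd⟩, hyu⟩ := hC (v ∘ Sum.inl + v ∘ Sum.inr ∘ Sum.inr)
  rw [← vasVec_eta v]
  generalize v ∘ Sum.inl = a at *
  generalize v (Sum.inr (Sum.inl ())) = b at *
  generalize v ∘ Sum.inr ∘ Sum.inr = c at *
  rw [hammingDist_eq_hammingNorm_add] at hyd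
  have hne {s t : ZMod 2} : s ≠ t → s = t + 1 := by
    revert s t
    decide
  apply existsUnique_of_exists_of_unique
  · by_cases hb : b = wt c
    · refine ⟨vasVec (c + y) b c, vasVec_mem_Vasiliev.mpr ⟨hb, ?_⟩, ?_⟩
      · rwa [add_right_comm, ZModModule.add_self, zero_add]
      · simpa [hammingDist_eq_hammingNorm_add, vasVec_add, hammingNorm_vasVec,
          ZModModule.add_self, ← add_assoc] using hyd
    · have hay : a + y = c + (a + c + y) := by
        rw [add_right_comm a c y, add_comm c, add_assoc, ZModModule.add_self, add_zero]
      rcases Nat.le_one_iff_eq_zero_or_eq_one.mp hyd with h | h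
      · refine ⟨vasVec a (wt c) c, vasVec_mem_Vasiliev.mpr ⟨rfl, ?_⟩, ?_⟩
        · rwa [eq_of_add_eq_zero (hammingNorm_eq_zero.mp h)]
        · rw [hammingDist_eq_hammingNorm_add, vasVec_add, hammingNorm_vasVec,
            ZModModule.add_self, ZModModule.add_self, hammingNorm_zero]
          split_ifs <;> simp
      · refine ⟨vasVec a b (a + y), vasVec_mem_Vasiliev.mpr ⟨?_, ?_⟩, ?_⟩
        · rw [hay, wt_add, wt_eq_hammingNorm (a + c + y), h, Nat.cast_one]
          exact hne hb
        · rwa [← add_assoc, ZModModule.add_self, zero_add]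
        · rw [hammingDist_eq_hammingNorm_add, vasVec_add, hammingNorm_vasVec,
            ZModModule.add_self, ZModModule.add_self, hammingNorm_zero, hay, ← add_assoc,
            ZModModule.add_self, zero_add, zero_add, h]
          simp
  · have sum_eq {a' c' : F ι} {b' : ZMod 2} (hm : vasVec a' b' c' ∈ Vasiliev C 0)
        (hd : hammingDist (vasVec a b c) (vasVec a' b' c') ≤ 1) : a' + c' = y := by
      refine hyu _ ⟨(vasVec_mem_Vasiliev.mp hm).2, ?_⟩
      rw [hammingDist_eq_hammingNorm_add, vasVec_add, hammingNorm_vasVec] at hd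
      rw [hammingDist_eq_hammingNorm_add, add_add_add_comm]
      have := hammingNorm_add_le (a + a') (c + c')
      omega
    rintro v₁ v₂ ⟨hm₁, hd₁⟩ ⟨hm₂, hd₂⟩
    have hd := hammingDist_triangle_left v₁ v₂ (vasVec a b c)
    rw [← vasVec_eta v₁] at *
    rw [← vasVec_eta v₂] at *
    generalize v₁ ∘ Sum.inl = a₁ at *
    generalize v₁ (Sum.inr (Sum.inl ())) = b₁ at *
    generalize v₁ ∘ Sum.inr ∘ Sum.inr = c₁ at *
    generalize v₂ ∘ Sum.inl = a₂ at *
    generalize v₂ (Sum.inr (Sum.inl ())) = b₂ at *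
    generalize v₂ ∘ Sum.inr ∘ Sum.inr = c₂ at *
    have hs : a₁ + c₁ = a₂ + c₂ := (sum_eq hm₁ hd₁).trans (sum_eq hm₂ hd₂).symm
    have hac : a₁ + a₂ = c₁ + c₂ := by
      apply eq_of_add_eq_zero
      rw [add_add_add_comm, hs, ZModModule.add_self]
    obtain ⟨rfl, -⟩ := vasVec_mem_Vasiliev.mp hm₁
    obtain ⟨rfl, -⟩ := vasVec_mem_Vasiliev.mp hm₂
    have hd' : hammingDist (vasVec a₁ (wt c₁) c₁) (vasVec a₂ (wt c₂) c₂) ≤ 2 := by omega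
    rw [hammingDist_eq_hammingNorm_add, vasVec_add, hammingNorm_vasVec, hac, ← wt_add,
      wt_eq_hammingNorm] at hd'
    have hc : hammingNorm (c₁ + c₂) = 0 := by
      by_contra h
      have h1 : hammingNorm (c₁ + c₂) = 1 := by omega
      simp [h1] at hd'
    have hcc : c₁ = c₂ := eq_of_add_eq_zero (hammingNorm_eq_zero.mp hc)
    subst hcc
    rw [add_left_inj] at hs
    rw [hs]

theorem IsHomogeneous.vasiliev {C : Set (F ι)} (h0 : (0 : F ι) ∈ C) (hC : IsPerfect C)
    (hhom : IsHomogeneous C) : IsHomogeneous (Vasiliev C 0) := by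
  intro p hp
  rw [← vasVec_eta p] at hp ⊢
  generalize p ∘ Sum.inl = a at *
  generalize p (Sum.inr (Sum.inl ())) = b at *
  generalize p ∘ Sum.inr ∘ Sum.inr = c at *
  obtain ⟨rfl, hy⟩ := vasVec_mem_Vasiliev.mp hp
  obtain ⟨π, hπ⟩ := hhom _ hy
  rw [image_STS_eq_iff] at hπ
  have transfer (w : F ι) (hw : hammingNorm w ≤ 3) : w + (a + c) ∈ C ↔ permAct π w ∈ C := by
    rcases eq_or_ne (hammingNorm w) 3 with h3 | h3
    · simpa using hπ w h3
    · have hw2 : hammingNorm w ≤ 2 := by omega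
      have hπ0 : permAct π (0 : F ι) = 0 := rfl
      constructor
      · intro h
        have := hC.eq_of_hammingDist_le_two h hy (by
          rwa [hammingDist_eq_hammingNorm_add, add_assoc, ZModModule.add_self, add_zero])
        rw [add_eq_right.mp this, hπ0]
        exact h0
      · intro h
        have := hC.eq_of_hammingDist_le_two h h0 (by
          rwa [hammingDist_zero_right, hammingNorm_permAct])
        have hw0 : hammingNorm w = 0 := by rw [← hammingNorm_permAct π, this, hammingNorm_zero]
        rwa [hammingNorm_eq_zero.mp hw0, zero_add]
  refine ⟨dup π, image_STS_eq_iff.mpr fun v hv => ?_⟩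
  rw [add_zero, permAct_dup]
  rw [← vasVec_eta v] at hv
  conv_lhs => rw [← vasVec_eta v]
  generalize v ∘ Sum.inl = a' at *
  generalize v (Sum.inr (Sum.inl ())) = b' at *
  generalize v ∘ Sum.inr ∘ Sum.inr = c' at *
  rw [hammingNorm_vasVec] at hv
  have hac := hammingNorm_add_le a' c'
  rw [vasVec_add, vasVec_mem_Vasiliev, vasVec_mem_Vasiliev, wt_add, add_left_inj, wt_permAct,
    ← permAct_add, add_add_add_comm, transfer _ (by omega)]

end VasilievHomogeneous

/-- the Vasil'ev code of a homogeneous perfect code, with zero function,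
is a homogeneous perfect code. -/
theorem stmt4 {n : ℕ} (C : Set (F (Fin n))) (h0 : (0 : F (Fin n)) ∈ C)
    (hC : IsPerfect C) (hhom : IsHomogeneous C) :
    IsPerfect (Vasiliev C 0) ∧ IsHomogeneous (Vasiliev C 0) := by
  exact ⟨hC.vasiliev, hhom.vasiliev h0 hC⟩
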